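/- arXiv:1510.06467 — 3 statements merged into one kernel-verified Lean document; each statement's English description precedes it below -/
import Mathlib

section
/- Let A ⊆ ℝ^m be a bounded infinite set. Let (M_n)_{n≥1} be the strictly increasing enumeration of the range of N_B(A,·), and for each n set l_n⁻¹ := sup{x > 0 : N_B(A,x) = M_n} (which is finite since N_B(A,x) → ∞ as x → ∞), m_1 := M_2, and m_n := M_{n+1} − M_n for n ≥ 2; the box-counting fractal string L_B of A is the fractal string with distinct lengths (l_n)_{n≥1} and corresponding multiplicities (m_n)_{n≥1}. Then D_{L_B} := inf{α ∈ ℝ : ∑_{n≥1} m_n l_n^α < ∞} equals the upper box-counting dimension of A, i.e., D_{L_B} = limsup_{x→∞} log N_B(A,x)/log x. -/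
open Filter Topology Metric

/-- The box-counting function `N_B(A,x)`: the maximal number of pairwise disjoint closed
balls of radius `x⁻¹` whose centers lie in `A`. -/
noncomputable def boxCount {m : ℕ} (A : Set (EuclideanSpace ℝ (Fin m))) (x : ℝ) : ℕ :=
  sSup {n : ℕ | ∃ c : Fin n → EuclideanSpace ℝ (Fin m), (∀ i, c i ∈ A) ∧
    Pairwise fun i j => Disjoint (closedBall (c i) x⁻¹) (closedBall (c j) x⁻¹)}

open MeasureTheory in
/-- Volume bound on packings: pairwise disjoint closed balls of radius `x⁻¹ ≤ 1` centred in a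
ball of radius `R` number at most `(R + 1) ^ m * x ^ m`. -/
lemma card_le_of_pairwise_disjoint_closedBall {m : ℕ} {R x : ℝ} (hR : 0 ≤ R) (hx : 1 ≤ x) {n : ℕ}
    (c : Fin n → EuclideanSpace ℝ (Fin m)) (hc : ∀ i, c i ∈ closedBall 0 R)
    (hd : Pairwise fun i j => Disjoint (closedBall (c i) x⁻¹) (closedBall (c j) x⁻¹)) :
    (n : ℝ) ≤ (R + 1) ^ m * x ^ m := by
  have hx0 : 0 < x := by linarith
  have hsub : (⋃ i, closedBall (c i) x⁻¹) ⊆ closedBall 0 (R + 1) := by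
    refine Set.iUnion_subset fun i => closedBall_subset_closedBall' ?_
    have h1 : dist (c i) 0 ≤ R := hc i
    have h2 : x⁻¹ ≤ 1 := inv_le_one_of_one_le₀ hx
    linarith
  have hvol := measure_mono (μ := volume) hsub
  rw [measure_iUnion hd fun i => isClosed_closedBall.measurableSet, tsum_fintype] at hvol
  simp only [Measure.addHaar_closedBall volume _ (inv_nonneg.2 hx0.le),
    Measure.addHaar_closedBall volume _ (by linarith : (0 : ℝ) ≤ R + 1), Finset.sum_const,
    Finset.card_univ, Fintype.card_fin, finrank_euclideanSpace, nsmul_eq_mul, ← mul_assoc] at hvol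
  rw [ENNReal.mul_le_mul_iff_left (measure_ball_pos volume _ one_pos).ne' measure_ball_lt_top.ne,
    ← ENNReal.ofReal_natCast, ← ENNReal.ofReal_mul (by positivity),
    ENNReal.ofReal_le_ofReal_iff (by positivity)] at hvol
  calc (n : ℝ) = n * x⁻¹ ^ m * x ^ m := by
        rw [mul_assoc, ← mul_pow, inv_mul_cancel₀ hx0.ne', one_pow, mul_one]
    _ ≤ _ := by gcongr

lemma bddAbove_packing {m : ℕ} {A : Set (EuclideanSpace ℝ (Fin m))} (hA : Bornology.IsBounded A)
    {x : ℝ} (hx : 0 < x) :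
    BddAbove {n : ℕ | ∃ c : Fin n → EuclideanSpace ℝ (Fin m), (∀ i, c i ∈ A) ∧
      Pairwise fun i j => Disjoint (closedBall (c i) x⁻¹) (closedBall (c j) x⁻¹)} := by
  obtain ⟨R, hR0, hR⟩ := hA.subset_closedBall_lt 0 0
  refine ⟨⌊(R + 1) ^ m * (max x 1) ^ m⌋₊, ?_⟩
  rintro n ⟨c, hc, hd⟩
  refine Nat.le_floor (card_le_of_pairwise_disjoint_closedBall hR0.le (le_max_right _ _) c
    (fun i => hR (hc i)) fun i j hij => ?_)
  have h : (max x 1)⁻¹ ≤ x⁻¹ := by gcongr; exact le_max_left _ _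
  exact (hd hij).mono (closedBall_subset_closedBall h) (closedBall_subset_closedBall h)

lemma boxCount_mem {m : ℕ} {A : Set (EuclideanSpace ℝ (Fin m))} (hA : Bornology.IsBounded A)
    {x : ℝ} (hx : 0 < x) :
    ∃ c : Fin (boxCount A x) → EuclideanSpace ℝ (Fin m), (∀ i, c i ∈ A) ∧
      Pairwise fun i j => Disjoint (closedBall (c i) x⁻¹) (closedBall (c j) x⁻¹) :=
  Nat.sSup_mem (s := {n : ℕ | ∃ c : Fin n → EuclideanSpace ℝ (Fin m), (∀ i, c i ∈ A) ∧
      Pairwise fun i j => Disjoint (closedBall (c i) x⁻¹) (closedBall (c j) x⁻¹)})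
    ⟨0, fun i => i.elim0, fun i => i.elim0, fun i => i.elim0⟩ (bddAbove_packing hA hx)

lemma boxCount_monotoneOn {m : ℕ} {A : Set (EuclideanSpace ℝ (Fin m))}
    (hA : Bornology.IsBounded A) : MonotoneOn (boxCount A) (Set.Ioi 0) := by
  intro x hx y hy hxy
  obtain ⟨c, hc, hd⟩ := boxCount_mem hA hx
  refine le_csSup (bddAbove_packing hA hy) ⟨c, hc, fun i j hij => ?_⟩
  have h : y⁻¹ ≤ x⁻¹ := inv_anti₀ hx hxy
  exact (hd hij).mono (closedBall_subset_closedBall h) (closedBall_subset_closedBall h)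

lemma exists_boxCount_le {m : ℕ} {A : Set (EuclideanSpace ℝ (Fin m))}
    (hA : Bornology.IsBounded A) :
    ∃ C : ℝ, ∀ x, 1 ≤ x → (boxCount A x : ℝ) ≤ C * x ^ (m : ℝ) := by
  obtain ⟨R, hR0, hR⟩ := hA.subset_closedBall_lt 0 0
  refine ⟨(R + 1) ^ m, fun x hx => ?_⟩
  obtain ⟨c, hc, hd⟩ := boxCount_mem hA (zero_lt_one.trans_le hx)
  rw [Real.rpow_natCast]
  exact card_le_of_pairwise_disjoint_closedBall hR0.le hx c (fun i => hR (hc i)) hd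

lemma eventually_log_div_log_le {N : ℝ → ℕ} {C α ε : ℝ} (hα : 0 ≤ α) (hε : 0 < ε)
    (h : ∀ᶠ x in atTop, (N x : ℝ) ≤ C * x ^ α) :
    ∀ᶠ x in atTop, Real.log (N x) / Real.log x ≤ α + ε := by
  have hlim := (Real.tendsto_log_atTop.const_mul_atTop hε).eventually_ge_atTop (Real.log C)
  filter_upwards [h, hlim, eventually_gt_atTop 1] with x hN hC hx
  have hlog : 0 < Real.log x := Real.log_pos hx
  have hx0 : 0 < x := by linarith
  rw [div_le_iff₀ hlog]
  rcases Nat.eq_zero_or_pos (N x) with h0 | h0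
  · rw [h0]
    simp only [Nat.cast_zero, Real.log_zero]
    positivity
  · have hN0 : (0 : ℝ) < N x := by exact_mod_cast h0
    have hpow : 0 < x ^ α := Real.rpow_pos_of_pos hx0 α
    have hC0 : 0 < C := pos_of_mul_pos_left (hN0.trans_le hN) hpow.le
    have hle := Real.log_le_log hN0 hN
    rw [Real.log_mul hC0.ne' hpow.ne', Real.log_rpow hx0] at hle
    linarith

lemma summable_sub_mul_rpow_neg {M : ℕ → ℕ} (hM : Monotone M) {s : ℝ} (hs : 1 < s) :
    Summable fun n => ((M (n + 1) : ℝ) - M n) * (M (n + 1) : ℝ) ^ (-s) := by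
  have hsum : Summable fun k : ℕ => ((k + 1 : ℕ) : ℝ) ^ (-s) :=
    (summable_nat_add_iff 1).2 (Real.summable_nat_rpow.2 (by linarith))
  have hstep : ∀ n, ((M (n + 1) : ℝ) - M n) * (M (n + 1) : ℝ) ^ (-s) ≤
      ∑ k ∈ Finset.Ico (M n) (M (n + 1)), ((k + 1 : ℕ) : ℝ) ^ (-s) := by
    intro n
    have hcard : ((M (n + 1) : ℝ) - M n) = (Finset.Ico (M n) (M (n + 1))).card := by
      rw [Nat.card_Ico, Nat.cast_sub (hM n.le_succ)]
    rw [hcard, ← nsmul_eq_mul]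
    refine Finset.card_nsmul_le_sum _ _ _ fun k hk => ?_
    refine Real.rpow_le_rpow_of_nonpos (by positivity) ?_ (by linarith)
    exact_mod_cast (Finset.mem_Ico.1 hk).2
  have hpartial : ∀ K, ∑ n ∈ Finset.range K,
      ((M (n + 1) : ℝ) - M n) * (M (n + 1) : ℝ) ^ (-s) ≤
      ∑ k ∈ Finset.Ico (M 0) (M K), ((k + 1 : ℕ) : ℝ) ^ (-s) := by
    intro K
    induction K with
    | zero => simp
    | succ K ih =>
      rw [Finset.sum_range_succ, ← Finset.sum_Ico_consecutive _ (hM K.zero_le) (hM K.le_succ)]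
      exact add_le_add ih (hstep K)
  refine summable_of_sum_range_le (c := ∑' k : ℕ, ((k + 1 : ℕ) : ℝ) ^ (-s)) (fun n => ?_)
    fun K => (hpartial K).trans (hsum.sum_le_tsum _ fun k _ => by positivity)
  have : (M n : ℝ) ≤ M (n + 1) := by exact_mod_cast hM n.le_succ
  exact mul_nonneg (by linarith) (by positivity)

section CountingFunction

variable {N : ℝ → ℕ} {M : ℕ → ℕ} {l : ℕ → ℝ}

lemma exists_eq_of_range (hMrange : Set.range M = N '' Set.Ioi (0 : ℝ)) (n : ℕ) :
    ∃ x, 0 < x ∧ N x = M n := by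
  obtain ⟨x, hx, h⟩ : M n ∈ N '' Set.Ioi (0 : ℝ) := hMrange ▸ Set.mem_range_self n
  exact ⟨x, hx, h⟩

lemma lt_of_count_lt (hN : MonotoneOn N (Set.Ioi 0)) {x y : ℝ} (hx : 0 < x) (hy : 0 < y)
    (h : N x < N y) : x < y := by
  by_contra! hyx
  exact absurd (hN hy hx hyx) (not_le.2 h)

lemma inv_length_le (hN : MonotoneOn N (Set.Ioi 0))
    (hMrange : Set.range M = N '' Set.Ioi (0 : ℝ))
    (hl : ∀ n, (l n)⁻¹ = sSup {x : ℝ | 0 < x ∧ N x = M n}) {n : ℕ} {y : ℝ} (hy : 0 < y)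
    (h : M n < N y) : (l n)⁻¹ ≤ y := by
  rw [hl]
  refine csSup_le (exists_eq_of_range hMrange n) ?_
  rintro x ⟨hx, hxn⟩
  exact (lt_of_count_lt hN hx hy (hxn ▸ h)).le

lemma le_inv_length (hN : MonotoneOn N (Set.Ioi 0)) (hM : StrictMono M)
    (hMrange : Set.range M = N '' Set.Ioi (0 : ℝ))
    (hl : ∀ n, (l n)⁻¹ = sSup {x : ℝ | 0 < x ∧ N x = M n}) {n : ℕ} {y : ℝ} (hy : 0 < y)
    (h : N y ≤ M n) : y ≤ (l n)⁻¹ := by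
  have hbdd : BddAbove {x : ℝ | 0 < x ∧ N x = M n} := by
    obtain ⟨z, hz, hzn⟩ := exists_eq_of_range hMrange (n + 1)
    refine ⟨z, ?_⟩
    rintro x ⟨hx, hxn⟩
    exact (lt_of_count_lt hN hx hz (by rw [hxn, hzn]; exact hM n.lt_succ_self)).le
  rw [hl]
  rcases h.lt_or_eq with h | h
  · obtain ⟨x, hx, hxn⟩ := exists_eq_of_range hMrange n
    exact (lt_of_count_lt hN hy hx (hxn ▸ h)).le.trans (le_csSup hbdd ⟨hx, hxn⟩)
  · exact le_csSup hbdd ⟨hy, h⟩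

lemma length_pos (hN : MonotoneOn N (Set.Ioi 0)) (hM : StrictMono M)
    (hMrange : Set.range M = N '' Set.Ioi (0 : ℝ))
    (hl : ∀ n, (l n)⁻¹ = sSup {x : ℝ | 0 < x ∧ N x = M n}) (n : ℕ) : 0 < l n := by
  obtain ⟨x, hx, hxn⟩ := exists_eq_of_range hMrange n
  exact inv_pos.1 (hx.trans_le (le_inv_length hN hM hMrange hl hx hxn.le))

lemma length_antitone (hN : MonotoneOn N (Set.Ioi 0)) (hM : StrictMono M)
    (hMrange : Set.range M = N '' Set.Ioi (0 : ℝ))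
    (hl : ∀ n, (l n)⁻¹ = sSup {x : ℝ | 0 < x ∧ N x = M n}) : Antitone l := by
  refine antitone_nat_of_succ_le fun n => ?_
  obtain ⟨x, hx, hxn⟩ := exists_eq_of_range hMrange (n + 1)
  rw [← inv_le_inv₀ (length_pos hN hM hMrange hl n) (length_pos hN hM hMrange hl (n + 1))]
  exact (inv_length_le hN hMrange hl hx (by rw [hxn]; exact hM n.lt_succ_self)).trans
    (le_inv_length hN hM hMrange hl hx hxn.le)

lemma tendsto_inv_length (hN : MonotoneOn N (Set.Ioi 0)) (hM : StrictMono M)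
    (hMrange : Set.range M = N '' Set.Ioi (0 : ℝ))
    (hl : ∀ n, (l n)⁻¹ = sSup {x : ℝ | 0 < x ∧ N x = M n}) :
    Tendsto (fun n => (l n)⁻¹) atTop atTop := by
  refine tendsto_atTop.2 fun X => ?_
  filter_upwards [eventually_ge_atTop (N (max X 1))] with n hn
  exact (le_max_left X 1).trans (le_inv_length hN hM hMrange hl
    (zero_lt_one.trans_le (le_max_right X 1)) (hn.trans (hM.le_apply)))

lemma le_count_of_inv_length_lt (hN : MonotoneOn N (Set.Ioi 0)) (hM : StrictMono M)
    (hMrange : Set.range M = N '' Set.Ioi (0 : ℝ))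
    (hl : ∀ n, (l n)⁻¹ = sSup {x : ℝ | 0 < x ∧ N x = M n}) {n : ℕ} {y : ℝ}
    (h : (l n)⁻¹ < y) : M (n + 1) ≤ N y := by
  have hy : 0 < y := (inv_pos.2 (length_pos hN hM hMrange hl n)).trans h
  have hlt : M n < N y := by
    by_contra! hle
    exact absurd (le_inv_length hN hM hMrange hl hy hle) (not_le.2 h)
  obtain ⟨k, hk⟩ : N y ∈ Set.range M := hMrange ▸ Set.mem_image_of_mem N hy
  rw [← hk] at hlt ⊢
  exact hM.monotone (hM.lt_iff_lt.1 hlt)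

lemma summable_of_eventually_count_le (hN : MonotoneOn N (Set.Ioi 0)) (hM : StrictMono M)
    (hMrange : Set.range M = N '' Set.Ioi (0 : ℝ))
    (hl : ∀ n, (l n)⁻¹ = sSup {x : ℝ | 0 < x ∧ N x = M n})
    {mm : ℕ → ℕ} (hmm : ∀ n, 1 ≤ n → mm n = M (n + 1) - M n) {α β : ℝ} (hβ : 0 < β)
    (hβα : β < α) (h : ∀ᶠ x in atTop, (N x : ℝ) ≤ x ^ β) :
    Summable fun n => (mm n : ℝ) * l n ^ α := by
  obtain ⟨X, hX⟩ := eventually_atTop.1 h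
  refine Summable.of_norm_bounded_eventually_nat
    (summable_sub_mul_rpow_neg hM.monotone ((one_lt_div hβ).2 hβα)) ?_
  filter_upwards [(tendsto_inv_length hN hM hMrange hl).eventually_ge_atTop X,
    eventually_ge_atTop 1] with n hn hn1
  have hpos := length_pos hN hM hMrange hl n
  have hinv : 0 < (l n)⁻¹ := inv_pos.2 hpos
  have hle : (M (n + 1) : ℝ) ≤ (l n)⁻¹ ^ β := by
    have hcont : Tendsto (fun y : ℝ => y ^ β) (𝓝[>] (l n)⁻¹) (𝓝 ((l n)⁻¹ ^ β)) :=
      ((Real.continuousAt_rpow_const _ _ (Or.inl hinv.ne')).tendsto).mono_left nhdsWithin_le_nhds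
    refine ge_of_tendsto hcont (eventually_mem_nhdsWithin.mono fun y hy => ?_)
    refine le_trans ?_ (hX y (hn.trans (le_of_lt hy)))
    exact_mod_cast le_count_of_inv_length_lt hN hM hMrange hl hy
  have hM0 : (0 : ℝ) < M (n + 1) := by
    exact_mod_cast (Nat.zero_le _).trans_lt (hM n.lt_succ_self)
  have hpow : l n ^ α ≤ (M (n + 1) : ℝ) ^ (-(α / β)) := by
    calc l n ^ α = ((l n)⁻¹ ^ β) ^ (-(α / β)) := by
          rw [← Real.rpow_mul hinv.le, Real.inv_rpow hpos.le, ← Real.rpow_neg hpos.le]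
          congr 1
          field_simp
      _ ≤ _ := Real.rpow_le_rpow_of_nonpos hM0 hle
          (neg_nonpos.2 (div_nonneg (hβ.trans hβα).le hβ.le))
  rw [hmm n hn1, Nat.cast_sub (hM n.lt_succ_self).le, Real.norm_of_nonneg]
  · have : (M n : ℝ) ≤ M (n + 1) := by exact_mod_cast (hM n.lt_succ_self).le
    exact mul_le_mul_of_nonneg_left hpow (by linarith)
  · have : (M n : ℝ) ≤ M (n + 1) := by exact_mod_cast (hM n.lt_succ_self).le
    exact mul_nonneg (by linarith) (Real.rpow_nonneg hpos.le _)

lemma nonneg_of_summable (hN : MonotoneOn N (Set.Ioi 0)) (hM : StrictMono M)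
    (hMrange : Set.range M = N '' Set.Ioi (0 : ℝ))
    (hl : ∀ n, (l n)⁻¹ = sSup {x : ℝ | 0 < x ∧ N x = M n})
    {mm : ℕ → ℕ} (hmm : ∀ n, 1 ≤ n → mm n = M (n + 1) - M n) {α : ℝ}
    (h : Summable fun n => (mm n : ℝ) * l n ^ α) : 0 ≤ α := by
  by_contra! hα
  have hev := h.tendsto_atTop_zero.eventually_lt_const one_pos
  obtain ⟨n, hlt, hn, hn1⟩ := (hev.and
    (((tendsto_inv_length hN hM hMrange hl).eventually_ge_atTop 1).and
      (eventually_ge_atTop 1))).exists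
  have hpos := length_pos hN hM hMrange hl n
  have h1 : 1 ≤ l n ^ α :=
    Real.one_le_rpow_of_pos_of_le_one_of_nonpos hpos ((one_le_inv₀ hpos).1 hn) hα.le
  have h2 : (1 : ℝ) ≤ mm n := by
    have := hM n.lt_succ_self
    rw [hmm n hn1]
    exact_mod_cast Nat.sub_pos_of_lt this
  exact absurd hlt (not_lt.2 (one_le_mul_of_one_le_of_one_le h2 h1))

lemma eventually_count_le_of_summable (hN : MonotoneOn N (Set.Ioi 0)) (hM : StrictMono M)
    (hMrange : Set.range M = N '' Set.Ioi (0 : ℝ))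
    (hl : ∀ n, (l n)⁻¹ = sSup {x : ℝ | 0 < x ∧ N x = M n})
    {mm : ℕ → ℕ} (hmm0 : mm 0 = M 1) (hmm : ∀ n, 1 ≤ n → mm n = M (n + 1) - M n) {α : ℝ}
    (hα : 0 ≤ α) (h : Summable fun n => (mm n : ℝ) * l n ^ α) :
    ∀ᶠ x in atTop, (N x : ℝ) ≤ (∑' n, (mm n : ℝ) * l n ^ α) * x ^ α := by
  have hpos := length_pos hN hM hMrange hl
  have hsum : ∀ n, ∑ k ∈ Finset.range (n + 1), (mm k : ℝ) = M (n + 1) := by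
    intro n
    induction n with
    | zero => simp [hmm0]
    | succ n ih =>
      rw [Finset.sum_range_succ, ih, hmm (n + 1) n.succ_pos,
        Nat.cast_sub (hM (n + 1).lt_succ_self).le]
      ring
  filter_upwards [eventually_gt_atTop (l 0)⁻¹] with x hx
  have hx0 : 0 < x := (inv_pos.2 (hpos 0)).trans hx
  obtain ⟨k, hk⟩ : N x ∈ Set.range M := hMrange ▸ Set.mem_image_of_mem N hx0
  have hk1 : 0 + 1 ≤ k := by
    rw [← hM.le_iff_le, hk]
    exact le_count_of_inv_length_lt hN hM hMrange hl hx
  obtain ⟨n, rfl⟩ : ∃ n, k = n + 1 := ⟨k - 1, by omega⟩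
  have hxn : (l n)⁻¹ ≤ x :=
    inv_length_le hN hMrange hl hx0 (by rw [← hk]; exact hM n.lt_succ_self)
  have hlow : (M (n + 1) : ℝ) * l n ^ α ≤ ∑' n, (mm n : ℝ) * l n ^ α := by
    rw [← hsum n, Finset.sum_mul]
    refine le_trans (Finset.sum_le_sum fun k hk => ?_) (h.sum_le_tsum (Finset.range (n + 1))
      fun k _ => mul_nonneg (Nat.cast_nonneg _) (Real.rpow_nonneg (hpos k).le _))
    refine mul_le_mul_of_nonneg_left (Real.rpow_le_rpow (hpos n).le ?_ hα) (Nat.cast_nonneg _)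
    exact length_antitone hN hM hMrange hl (Nat.lt_succ_iff.1 (Finset.mem_range.1 hk))
  have hone : 1 ≤ l n ^ α * x ^ α := by
    rw [← Real.mul_rpow (hpos n).le hx0.le]
    refine Real.one_le_rpow ?_ hα
    rwa [inv_le_iff_one_le_mul₀' (hpos n)] at hxn
  rw [← hk]
  calc (M (n + 1) : ℝ) ≤ M (n + 1) * (l n ^ α * x ^ α) :=
        le_mul_of_one_le_right (Nat.cast_nonneg _) hone
    _ = M (n + 1) * l n ^ α * x ^ α := by ring
    _ ≤ _ := mul_le_mul_of_nonneg_right hlow (Real.rpow_nonneg hx0.le _)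

end CountingFunction

/-- Let `A ⊆ ℝ^m` be bounded and infinite, `M` the strictly increasing enumeration of the
range of `N_B(A,·)` on `(0,∞)` (indexed from `0`, so `M n` is the paper's `M_{n+1}`),
`l n` the distinct lengths defined by `(l n)⁻¹ = sup {x > 0 : N_B(A,x) = M n}`, and `mm` the
multiplicities `mm 0 = M 1`, `mm n = M (n+1) - M n` for `n ≥ 1`. Then the dimension
`D_{L_B} = inf {α : ∑ mm_n l_n^α < ∞}` of the box-counting fractal string equals the upper
box-counting dimension `limsup_{x→∞} log N_B(A,x)/log x` of `A`. -/
theorem stmt12 {m : ℕ} (A : Set (EuclideanSpace ℝ (Fin m)))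
    (hbdd : Bornology.IsBounded A) (hinf : A.Infinite)
    (M : ℕ → ℕ) (hM : StrictMono M)
    (hMrange : Set.range M = (fun x => boxCount A x) '' Set.Ioi (0 : ℝ))
    (l : ℕ → ℝ) (hl : ∀ n, (l n)⁻¹ = sSup {x : ℝ | 0 < x ∧ boxCount A x = M n})
    (mm : ℕ → ℕ) (hmm0 : mm 0 = M 1) (hmm : ∀ n, 1 ≤ n → mm n = M (n + 1) - M n) :
    sInf {α : ℝ | Summable fun n => (mm n : ℝ) * l n ^ α} =
      Filter.limsup (fun x : ℝ => Real.log (boxCount A x) / Real.log x) Filter.atTop := by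
  have hN := boxCount_monotoneOn hbdd
  obtain ⟨C, hC⟩ := exists_boxCount_le hbdd
  have hupper : IsBoundedUnder (· ≤ ·) atTop
      fun x : ℝ => Real.log (boxCount A x) / Real.log x :=
    isBoundedUnder_of_eventually_le (eventually_log_div_log_le (Nat.cast_nonneg m) one_pos
      (eventually_atTop.2 ⟨1, hC⟩))
  have hnonneg : ∀ᶠ x : ℝ in atTop, 0 ≤ Real.log (boxCount A x) / Real.log x := by
    filter_upwards [eventually_ge_atTop 1] with x hx
    exact div_nonneg (Real.log_natCast_nonneg _) (Real.log_nonneg hx)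
  have hlower : IsCoboundedUnder (· ≤ ·) atTop
      fun x : ℝ => Real.log (boxCount A x) / Real.log x :=
    (isBoundedUnder_of_eventually_ge hnonneg).isCoboundedUnder_le
  set d := limsup (fun x : ℝ => Real.log (boxCount A x) / Real.log x) atTop with hd
  have hd0 : 0 ≤ d := le_limsup_of_frequently_le hnonneg.frequently hupper
  have hmem : ∀ α, d < α → Summable fun n => (mm n : ℝ) * l n ^ α := by
    intro α hα
    obtain ⟨β, hdβ, hβα⟩ := exists_between hα
    refine summable_of_eventually_count_le hN hM hMrange hl hmm (hd0.trans_lt hdβ) hβα ?_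
    filter_upwards [eventually_lt_of_limsup_lt hdβ hupper, eventually_gt_atTop 1] with x hx hx1
    have hx0 : 0 < x := by linarith
    rcases Nat.eq_zero_or_pos (boxCount A x) with h0 | h0
    · rw [h0, Nat.cast_zero]
      positivity
    · rw [div_lt_iff₀ (Real.log_pos hx1)] at hx
      exact (Real.le_rpow_iff_log_le (by exact_mod_cast h0) hx0).2 hx.le
  refine le_antisymm (le_of_forall_gt_imp_ge_of_dense fun α hα => ?_)
    (le_csInf ⟨d + 1, hmem _ (lt_add_one d)⟩ fun α hα => ?_)
  · exact csInf_le ⟨0, fun γ hγ => nonneg_of_summable hN hM hMrange hl hmm hγ⟩ (hmem α hα)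
  · have hα0 := nonneg_of_summable hN hM hMrange hl hmm hα
    refine le_of_forall_pos_le_add fun ε hε => limsup_le_of_le hlower ?_
    exact eventually_log_div_log_le hα0 hε
      (eventually_count_le_of_summable hN hM hMrange hl hmm0 hmm hα0 hα)
end

section
/- Let Φ = {φ_j}_{j=1}^N be a self-similar system on ℝ^m satisfying the open set condition, with attractor F and scaling vector r, and set D := D_r. Then there exist constants γ > 0 and ε > 0 such that |N_B(F,x) − ∑_{j=1}^N N_B(F, r_j x)| ≤ γ·x^{D−ε} for all x ≥ 1. -/
open Filter Topology Metric

/-- `φ` is a contracting similarity with scaling ratio `ρ`. -/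
def IsSimilarity {X : Type*} [MetricSpace X] (φ : X → X) (ρ : ℝ) : Prop :=
  ∀ x y, dist (φ x) (φ y) = ρ * dist x y

section Similarity

variable {X : Type*} [MetricSpace X] {φ ψ : X → X} {ρ σ : ℝ}

lemma IsSimilarity.injective (h : IsSimilarity φ ρ) (hρ : 0 < ρ) : Function.Injective φ := by
  intro x y hxy
  have := h x y
  rw [hxy, dist_self] at this
  exact dist_eq_zero.1 ((mul_eq_zero.1 this.symm).resolve_left hρ.ne')

lemma IsSimilarity.comp (hφ : IsSimilarity φ ρ) (hψ : IsSimilarity ψ σ) :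
    IsSimilarity (φ ∘ ψ) (ρ * σ) := by
  intro x y
  rw [Function.comp_apply, Function.comp_apply, hφ, hψ, mul_assoc]

/-- A similarity of a finite-dimensional strictly convex space is surjective. -/
lemma IsSimilarity.surjective {E : Type*} [NormedAddCommGroup E] [NormedSpace ℝ E]
    [FiniteDimensional ℝ E] [StrictConvexSpace ℝ E] {φ : E → E} {ρ : ℝ}
    (h : IsSimilarity φ ρ) (hρ : 0 < ρ) : Function.Surjective φ := by
  have hiso : Isometry fun x => ρ⁻¹ • φ x := by
    refine Isometry.of_dist_eq fun x y => ?_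
    rw [dist_smul₀, h, Real.norm_of_nonneg (inv_nonneg.2 hρ.le), inv_mul_cancel_left₀ hρ.ne']
  let g := hiso.affineIsometryOfStrictConvexSpace
  have hg : Function.Surjective g :=
    (g.toAffineMap.linear_surjective_iff).1
      (LinearMap.injective_iff_surjective.1 g.linearIsometry.injective)
  intro y
  obtain ⟨x, hx⟩ := hg (ρ⁻¹ • y)
  exact ⟨x, smul_right_injective E (inv_ne_zero hρ.ne') hx⟩

end Similarity

section Word

variable {ι X : Type*}

/-- The composition of the maps `φ j` along a word. -/
def wordMap (φ : ι → X → X) : List ι → X → X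
  | [] => id
  | a :: w => φ a ∘ wordMap φ w

/-- The product of the ratios `r j` along a word. -/
def wordRatio (r : ι → ℝ) (w : List ι) : ℝ := (w.map r).prod

@[simp] lemma wordMap_nil (φ : ι → X → X) (x : X) : wordMap φ [] x = x := rfl

@[simp] lemma wordMap_cons (φ : ι → X → X) (a : ι) (w : List ι) (x : X) :
    wordMap φ (a :: w) x = φ a (wordMap φ w x) := rfl

@[simp] lemma wordRatio_nil (r : ι → ℝ) : wordRatio r [] = 1 := rfl

@[simp] lemma wordRatio_cons (r : ι → ℝ) (a : ι) (w : List ι) :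
    wordRatio r (a :: w) = r a * wordRatio r w := by simp [wordRatio]

@[simp] lemma wordMap_append (φ : ι → X → X) (u v : List ι) (x : X) :
    wordMap φ (u ++ v) x = wordMap φ u (wordMap φ v x) := by
  induction u with
  | nil => rfl
  | cons a u ih => simp [ih]

@[simp] lemma wordRatio_append (r : ι → ℝ) (u v : List ι) :
    wordRatio r (u ++ v) = wordRatio r u * wordRatio r v := by simp [wordRatio]

variable {φ : ι → X → X} {r : ι → ℝ}

lemma wordRatio_pos (hr : ∀ j, r j ∈ Set.Ioo (0 : ℝ) 1) (w : List ι) : 0 < wordRatio r w := by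
  induction w with
  | nil => simp
  | cons a w ih => simpa using mul_pos (hr a).1 ih

lemma wordRatio_le_one (hr : ∀ j, r j ∈ Set.Ioo (0 : ℝ) 1) (w : List ι) : wordRatio r w ≤ 1 := by
  induction w with
  | nil => simp
  | cons a w ih => simpa using mul_le_one₀ (hr a).2.le (wordRatio_pos hr w).le ih

lemma mapsTo_wordMap {A : Set X} (hA : ∀ j, Set.MapsTo (φ j) A A) (w : List ι) :
    Set.MapsTo (wordMap φ w) A A := by
  induction w with
  | nil => exact fun x hx => hx
  | cons a w ih => exact (hA a).comp ih

lemma surjective_wordMap (hφ : ∀ j, Function.Surjective (φ j)) (w : List ι) :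
    Function.Surjective (wordMap φ w) := by
  induction w with
  | nil => exact Function.surjective_id
  | cons a w ih => exact (hφ a).comp ih

lemma isSimilarity_wordMap [MetricSpace X] (hφ : ∀ j, IsSimilarity (φ j) (r j)) (w : List ι) :
    IsSimilarity (wordMap φ w) (wordRatio r w) := by
  induction w with
  | nil => intro x y; simp
  | cons a w ih =>
    rw [wordRatio_cons]
    exact (hφ a).comp ih

lemma exists_uniform_ratio_bounds [Finite ι] [Nonempty ι]
    (hr : ∀ j, r j ∈ Set.Ioo (0 : ℝ) 1) :
    ∃ c ρ : ℝ, 0 < c ∧ ρ ∈ Set.Ioo (0 : ℝ) 1 ∧ ∀ j, c ≤ r j ∧ r j ≤ ρ := by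
  obtain ⟨a, ha⟩ := Finite.exists_min r
  obtain ⟨b, hb⟩ := Finite.exists_max r
  exact ⟨r a, r b, (hr a).1, hr b, fun j => ⟨ha j, hb j⟩⟩

/-- Every point of a piece `φ i '' F` lies in a cylinder below that piece whose ratio is
comparable to a prescribed number `t ≤ 1`. -/
lemma exists_word_ratio_comparable {F : Set X} (hF : F ⊆ ⋃ j, φ j '' F)
    (hr : ∀ j, r j ∈ Set.Ioo (0 : ℝ) 1) {c ρ : ℝ} (hc : 0 < c) (hρ : ρ ∈ Set.Ioo (0 : ℝ) 1)
    (hcρ : ∀ j, c ≤ r j ∧ r j ≤ ρ) (i : ι) {q : X} (hq : q ∈ F) {t : ℝ} (ht : 0 < t)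
    (ht1 : t ≤ 1) :
    ∃ v, ∃ q' ∈ F, wordMap φ (i :: v) q' = φ i q ∧
      c * t ≤ wordRatio r (i :: v) ∧ wordRatio r (i :: v) ≤ t := by
  have key : ∀ k : ℕ, ∀ v, ∀ q' ∈ F, wordMap φ (i :: v) q' = φ i q →
      c * t ≤ wordRatio r (i :: v) → wordRatio r (i :: v) * ρ ^ k ≤ t →
      ∃ v, ∃ q' ∈ F, wordMap φ (i :: v) q' = φ i q ∧
        c * t ≤ wordRatio r (i :: v) ∧ wordRatio r (i :: v) ≤ t := by
    intro k
    induction k with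
    | zero => exact fun v q' hq' h1 h2 h3 => ⟨v, q', hq', h1, h2, by simpa using h3⟩
    | succ k ih =>
      intro v q' hq' h1 h2 h3
      by_cases hle : wordRatio r (i :: v) ≤ t
      · exact ⟨v, q', hq', h1, h2, hle⟩
      · obtain ⟨a, p, hp, rfl⟩ := Set.mem_iUnion.1 (hF hq')
        have hsplit : wordRatio r (i :: (v ++ [a])) = wordRatio r (i :: v) * r a := by
          simp [mul_assoc]
        refine ih (v ++ [a]) p hp (by simpa using h1) ?_ ?_
        · rw [hsplit, mul_comm]
          exact mul_le_mul (not_le.1 hle).le (hcρ a).1 hc.le (wordRatio_pos hr _).le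
        · refine le_trans ?_ h3
          rw [hsplit, pow_succ', mul_assoc]
          exact mul_le_mul_of_nonneg_left
            (mul_le_mul_of_nonneg_right (hcρ a).2 (pow_nonneg hρ.1.le k))
            (wordRatio_pos hr _).le
  obtain ⟨k, hk⟩ := exists_pow_lt_of_lt_one ht hρ.2
  refine key k [] q hq rfl ?_ ?_
  · simpa using (mul_le_of_le_one_right hc.le ht1).trans (hcρ i).1
  · exact (mul_le_of_le_one_left (pow_nonneg hρ.1.le k) (wordRatio_le_one hr _)).trans hk.le

end Word

/-- The complement of a word `u` in the tree of words is covered by finitely many cylinders, the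
`D`-th powers of whose ratios add up to `1 - wordRatio r u ^ D`. -/
lemma exists_complementary_words {ι X : Type*} [Fintype ι] {φ : ι → X → X} {r : ι → ℝ}
    {F : Set X} (hF : F ⊆ ⋃ j, φ j '' F) (hr : ∀ j, r j ∈ Set.Ioo (0 : ℝ) 1)
    {D : ℝ} (hD : ∑ j, r j ^ D = 1) (u : List ι) :
    ∃ (n : ℕ) (b : Fin n → List ι), (∀ k, b k ≠ []) ∧
      (∀ x ∈ F, x ∈ wordMap φ u '' F ∨ ∃ k, x ∈ wordMap φ (b k) '' F) ∧
      ∑ k, wordRatio r (b k) ^ D = 1 - wordRatio r u ^ D := by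
  classical
  suffices H : ∃ L : List (List ι), (∀ b ∈ L, b ≠ []) ∧
      (∀ x ∈ F, x ∈ wordMap φ u '' F ∨ ∃ b ∈ L, x ∈ wordMap φ b '' F) ∧
      (L.map fun b => wordRatio r b ^ D).sum = 1 - wordRatio r u ^ D by
    obtain ⟨L, h1, h2, h3⟩ := H
    refine ⟨L.length, L.get, fun k => h1 _ (L.get_mem k), fun x hx => ?_, ?_⟩
    · refine (h2 x hx).imp_right ?_
      rintro ⟨b, hb, hxb⟩
      obtain ⟨k, rfl⟩ := List.get_of_mem hb
      exact ⟨k, hxb⟩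
    · rw [← h3, ← Fin.sum_univ_fun_getElem L fun b => wordRatio r b ^ D]
      rfl
  induction u with
  | nil => exact ⟨[], by simp, fun x hx => Or.inl ⟨x, hx, rfl⟩, by simp⟩
  | cons a u ih =>
    obtain ⟨L, h1, h2, h3⟩ := ih
    refine ⟨(Finset.univ.erase a).toList.map (fun i => [i]) ++ L.map (a :: ·), ?_, ?_, ?_⟩
    · intro b hb
      rcases List.mem_append.1 hb with hb | hb
      · obtain ⟨i, -, rfl⟩ := List.mem_map.1 hb
        simp
      · obtain ⟨i, -, rfl⟩ := List.mem_map.1 hb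
        simp
    · intro x hx
      obtain ⟨j, y, hy, rfl⟩ := Set.mem_iUnion.1 (hF hx)
      by_cases hj : j = a
      · subst hj
        rcases h2 y hy with ⟨z, hz, rfl⟩ | ⟨b, hb, z, hz, rfl⟩
        · exact Or.inl ⟨z, hz, rfl⟩
        · exact Or.inr ⟨j :: b, by simp [hb], z, hz, rfl⟩
      · exact Or.inr ⟨[j], by simp [hj], y, hy, rfl⟩
    · have hsum : ∑ i ∈ Finset.univ.erase a, r i ^ D = 1 - r a ^ D := by
        rw [← hD, ← Finset.sum_erase_add _ _ (Finset.mem_univ a)]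
        ring
      have hmul : ∀ b, wordRatio r (a :: b) ^ D = r a ^ D * wordRatio r b ^ D := fun b => by
        rw [wordRatio_cons, Real.mul_rpow (hr a).1.le (wordRatio_pos hr b).le]
      simp only [List.map_append, List.map_map, List.sum_append, Function.comp_def, hmul,
        List.sum_map_mul_left, h3]
      simp only [wordRatio_cons, wordRatio_nil, mul_one, Finset.sum_map_toList, hsum]
      ring

section Packing

/-- In a finite-dimensional space, the number of `t * s`-separated points in a ball of radius
`t * R` is bounded independently of `t`. -/
lemma exists_card_le_of_separated (E : Type*) [NormedAddCommGroup E] [NormedSpace ℝ E]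
    [FiniteDimensional ℝ E] (R : ℝ) {s : ℝ} (hs : 0 < s) :
    ∃ K : ℕ, ∀ (S : Finset E) (x₀ : E) (t : ℝ), 0 < t → (∀ x ∈ S, dist x x₀ ≤ t * R) →
      (∀ x ∈ S, ∀ y ∈ S, x ≠ y → t * s ≤ dist x y) → S.card ≤ K := by
  obtain ⟨T, hTfin, hT⟩ := Metric.totallyBounded_iff.1
    (isCompact_closedBall (0 : E) R).totallyBounded (s / 2) (half_pos hs)
  refine ⟨hTfin.toFinset.card, fun S x₀ t ht hS hsep => ?_⟩
  have hscale : ∀ x y : E, dist (t⁻¹ • x) (t⁻¹ • y) = t⁻¹ * dist x y := fun x y => by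
    rw [dist_smul₀, Real.norm_of_nonneg (inv_nonneg.2 ht.le)]
  refine Finset.card_le_card_of_forall_subsingleton
    (fun x y => dist (t⁻¹ • (x - x₀)) y < s / 2) (fun x hx => ?_) fun y _ => ?_
  · have hmem : t⁻¹ • (x - x₀) ∈ closedBall (0 : E) R := by
      have h := hscale (x - x₀) 0
      rw [smul_zero, dist_zero_right (x - x₀), ← dist_eq_norm] at h
      rw [mem_closedBall, h, inv_mul_le_iff₀ ht]
      exact hS x hx
    obtain ⟨y, hy, hxy⟩ := Set.mem_iUnion₂.1 (hT hmem)
    exact ⟨y, hTfin.mem_toFinset.2 hy, hxy⟩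
  · rintro x ⟨hx, hxy⟩ x' ⟨hx', hxy'⟩
    by_contra hne
    have h1 := hsep x hx x' hx' hne
    have h2 := hscale (x - x₀) (x' - x₀)
    have h3 := dist_triangle_right (t⁻¹ • (x - x₀)) (t⁻¹ • (x' - x₀)) y
    rw [dist_sub_right] at h2
    have h4 : s ≤ t⁻¹ * dist x x' := (le_inv_mul_iff₀ ht).2 h1
    change dist _ _ < _ at hxy hxy'
    linarith

/-- Distinct points of `P` are at distance larger than `δ`. -/
def PairwiseFar {X : Type*} [MetricSpace X] (δ : ℝ) (P : Finset X) : Prop :=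
  ∀ x ∈ P, ∀ y ∈ P, x ≠ y → δ < dist x y

lemma PairwiseFar.mono {X : Type*} [MetricSpace X] {δ : ℝ} {P Q : Finset X}
    (h : PairwiseFar δ P) (hQ : Q ⊆ P) : PairwiseFar δ Q :=
  fun x hx y hy => h x (hQ hx) y (hQ hy)

variable {m : ℕ} {A : Set (EuclideanSpace ℝ (Fin m))} {x : ℝ}

lemma mem_boxCount_iff (hx : 0 < x) (n : ℕ) :
    (∃ c : Fin n → EuclideanSpace ℝ (Fin m), (∀ i, c i ∈ A) ∧
      Pairwise fun i j => Disjoint (closedBall (c i) x⁻¹) (closedBall (c j) x⁻¹)) ↔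
    ∃ P : Finset (EuclideanSpace ℝ (Fin m)), (P : Set _) ⊆ A ∧ PairwiseFar (2 / x) P ∧
      P.card = n := by
  have hx' : 0 ≤ x⁻¹ := (inv_pos.2 hx).le
  have h2 : x⁻¹ + x⁻¹ = 2 / x := by ring
  simp only [disjoint_closedBall_closedBall_iff hx' hx', h2]
  constructor
  · rintro ⟨c, hcA, hc⟩
    have hinj : Function.Injective c := fun i j hij => by
      by_contra hne
      have : 2 / x < dist (c i) (c j) := hc hne
      rw [hij, dist_self] at this
      exact this.not_ge (by positivity)
    refine ⟨Finset.univ.map ⟨c, hinj⟩, ?_, ?_, by simp⟩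
    · intro y hy
      obtain ⟨i, -, rfl⟩ := Finset.mem_map.1 hy
      exact hcA i
    · intro y hy z hz hyz
      obtain ⟨i, -, rfl⟩ := Finset.mem_map.1 hy
      obtain ⟨j, -, rfl⟩ := Finset.mem_map.1 hz
      exact hc fun hij => hyz (congrArg _ hij)
  · rintro ⟨P, hPA, hP, rfl⟩
    refine ⟨fun i => P.equivFin.symm i, fun i => hPA (P.equivFin.symm i).2, fun i j hij => ?_⟩
    exact hP _ (P.equivFin.symm i).2 _ (P.equivFin.symm j).2
      fun h => hij (P.equivFin.symm.injective (Subtype.ext h))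

lemma bddAbove_boxCount (hA : Bornology.IsBounded A) (hx : 0 < x) :
    BddAbove {n : ℕ | ∃ c : Fin n → EuclideanSpace ℝ (Fin m), (∀ i, c i ∈ A) ∧
      Pairwise fun i j => Disjoint (closedBall (c i) x⁻¹) (closedBall (c j) x⁻¹)} := by
  obtain ⟨R, hR⟩ := hA.subset_closedBall 0
  obtain ⟨K, hK⟩ := exists_card_le_of_separated (EuclideanSpace ℝ (Fin m)) R
    (show 0 < 2 / x by positivity)
  refine ⟨K, fun n hn => ?_⟩
  obtain ⟨P, hPA, hP, rfl⟩ := (mem_boxCount_iff hx n).1 hn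
  refine hK P 0 1 one_pos (fun y hy => ?_) fun y hy z hz hyz => ?_
  · simpa using hR (hPA hy)
  · simpa using (hP y hy z hz hyz).le

lemma card_le_boxCount (hA : Bornology.IsBounded A) (hx : 0 < x)
    {P : Finset (EuclideanSpace ℝ (Fin m))} (hPA : (P : Set _) ⊆ A)
    (hP : PairwiseFar (2 / x) P) : P.card ≤ boxCount A x :=
  le_csSup (bddAbove_boxCount hA hx) ((mem_boxCount_iff hx _).2 ⟨P, hPA, hP, rfl⟩)

lemma exists_card_eq_boxCount (hA : Bornology.IsBounded A) (hx : 0 < x) :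
    ∃ P : Finset (EuclideanSpace ℝ (Fin m)), (P : Set _) ⊆ A ∧ PairwiseFar (2 / x) P ∧
      P.card = boxCount A x :=
  (mem_boxCount_iff hx _).1 <| Nat.sSup_mem
    ⟨0, (mem_boxCount_iff hx 0).2 ⟨∅, by simp, by simp [PairwiseFar], rfl⟩⟩
    (bddAbove_boxCount hA hx)

lemma card_image_le_boxCount {φ : EuclideanSpace ℝ (Fin m) → EuclideanSpace ℝ (Fin m)} {ρ : ℝ}
    (hφ : IsSimilarity φ ρ) (hρ : 0 < ρ) (hA : Bornology.IsBounded A) (hx : 0 < x)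
    {P : Finset (EuclideanSpace ℝ (Fin m))} (hPA : (P : Set _) ⊆ φ '' A)
    (hP : PairwiseFar (2 / x) P) : P.card ≤ boxCount A (ρ * x) := by
  classical
  obtain ⟨Q, hQA, rfl⟩ := Finset.subset_set_image_iff.1 hPA
  rw [Finset.card_image_of_injective _ (hφ.injective hρ)]
  refine card_le_boxCount hA (by positivity) hQA fun y hy z hz hyz => ?_
  have h := hP _ (Finset.mem_image_of_mem φ hy) _ (Finset.mem_image_of_mem φ hz)
    ((hφ.injective hρ).ne hyz)
  rw [hφ, div_lt_iff₀ hx] at h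
  rw [div_lt_iff₀ (by positivity)]
  linarith

end Packing

section Separation

variable {ι E : Type*} [NormedAddCommGroup E] {φ : ι → E → E} {r : ι → ℝ}

/-- A finite family of words whose cylinders have ratio comparable to that of `u`, come close to
the cylinder of `u`, and are pairwise disjoint when applied to `V`. -/
structure IsNeighbourFamily (φ : ι → E → E) (r : ι → ℝ) (F V : Set E) (c : ℝ) (u : List ι)
    (S : Finset (List ι)) : Prop where
  le_ratio : ∀ v ∈ S, c * wordRatio r u ≤ wordRatio r v
  ratio_le : ∀ v ∈ S, wordRatio r v ≤ wordRatio r u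
  close : ∀ v ∈ S, ∃ p ∈ F, ∃ q ∈ F, dist (wordMap φ u p) (wordMap φ v q) ≤ wordRatio r u
  disjoint : ∀ v ∈ S, ∀ w ∈ S, v ≠ w → Disjoint (wordMap φ v '' V) (wordMap φ w '' V)

lemma exists_card_le_of_isNeighbourFamily [NormedSpace ℝ E] [FiniteDimensional ℝ E]
    [StrictConvexSpace ℝ E] (hr : ∀ j, r j ∈ Set.Ioo (0 : ℝ) 1)
    (hφ : ∀ j, IsSimilarity (φ j) (r j)) {F V : Set E} (hFb : Bornology.IsBounded F)
    (hVne : V.Nonempty) (hVo : IsOpen V) {c : ℝ} (hc : 0 < c) :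
    ∃ K : ℕ, ∀ u S, IsNeighbourFamily φ r F V c u S → S.card ≤ K := by
  classical
  obtain ⟨a, ha⟩ := hVne
  obtain ⟨ρ, hρ, hball⟩ := Metric.isOpen_iff.1 hVo a ha
  obtain ⟨R, hR⟩ := hFb.subset_closedBall a
  obtain ⟨K, hK⟩ := exists_card_le_of_separated E (R + 1 + R) (show 0 < c * ρ by positivity)
  refine ⟨K, fun u S h => ?_⟩
  have hsep : ∀ v ∈ S, ∀ w ∈ S, v ≠ w →
      wordRatio r u * (c * ρ) ≤ dist (wordMap φ v a) (wordMap φ w a) := by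
    intro v hv w hw hvw
    obtain ⟨b, hb⟩ := surjective_wordMap
      (fun j => (hφ j).surjective (hr j).1) w (wordMap φ v a)
    have hbV : b ∉ V := fun hbV => Set.disjoint_left.1 (h.disjoint v hv w hw hvw)
      (Set.mem_image_of_mem _ ha) ⟨b, hbV, hb⟩
    have hdist : ρ ≤ dist b a := not_lt.1 fun hlt => hbV (hball hlt)
    rw [← hb, isSimilarity_wordMap hφ w]
    calc wordRatio r u * (c * ρ) = c * wordRatio r u * ρ := by ring
      _ ≤ wordRatio r w * dist b a :=
        mul_le_mul (h.le_ratio w hw) hdist hρ.le (wordRatio_pos hr w).le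
  have hinj : Set.InjOn (fun v => wordMap φ v a) S := by
    intro v hv w hw hvw
    by_contra hne
    have h1 := hsep v hv w hw hne
    have h2 : 0 < wordRatio r u * (c * ρ) := mul_pos (wordRatio_pos hr u) (by positivity)
    simp only at hvw
    rw [hvw, dist_self] at h1
    exact h1.not_gt h2
  rw [← Finset.card_image_of_injOn hinj]
  refine hK _ (wordMap φ u a) _ (wordRatio_pos hr u) ?_ ?_
  · intro y hy
    obtain ⟨v, hv, rfl⟩ := Finset.mem_image.1 hy
    obtain ⟨p, hp, q, hq, hpq⟩ := h.close v hv
    have hp' : dist p a ≤ R := hR hp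
    have hq' : dist q a ≤ R := hR hq
    have h1 : dist (wordMap φ v a) (wordMap φ v q) ≤ wordRatio r u * R := by
      rw [isSimilarity_wordMap hφ v, dist_comm]
      exact mul_le_mul (h.ratio_le v hv) hq' dist_nonneg (wordRatio_pos hr u).le
    have h2 : dist (wordMap φ u p) (wordMap φ u a) ≤ wordRatio r u * R := by
      rw [isSimilarity_wordMap hφ u]
      exact mul_le_mul_of_nonneg_left hp' (wordRatio_pos hr u).le
    have h3 := dist_triangle4 (wordMap φ v a) (wordMap φ v q) (wordMap φ u p) (wordMap φ u a)
    rw [dist_comm (wordMap φ v q)] at h3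
    linarith
  · intro y hy z hz hyz
    obtain ⟨v, hv, rfl⟩ := Finset.mem_image.1 hy
    obtain ⟨w, hw, rfl⟩ := Finset.mem_image.1 hz
    exact hsep v hv w hw fun hvw => hyz (by rw [hvw])

/-- Under the open set condition there is a word `u` such that every cylinder ending in `u` is
far, relative to its size, from all the pieces of the attractor not containing it. -/
lemma exists_separating_word [Finite ι] [Nonempty ι] [NormedSpace ℝ E] [FiniteDimensional ℝ E]
    [StrictConvexSpace ℝ E] (hr : ∀ j, r j ∈ Set.Ioo (0 : ℝ) 1)
    (hφ : ∀ j, IsSimilarity (φ j) (r j)) {F V : Set E} (hFb : Bornology.IsBounded F)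
    (hF : F ⊆ ⋃ j, φ j '' F) (hVne : V.Nonempty) (hVo : IsOpen V)
    (hV : ∀ j, φ j '' V ⊆ V) (hVd : Pairwise fun i j => Disjoint (φ i '' V) (φ j '' V)) :
    ∃ u : List ι, ∀ i j w, i ≠ j → ∀ p ∈ F, ∀ q ∈ F,
      wordRatio r (j :: w ++ u) < dist (wordMap φ (j :: w ++ u) p) (φ i q) := by
  classical
  obtain ⟨c, ρ, hc, hρ, hcρ⟩ := exists_uniform_ratio_bounds hr
  obtain ⟨K, hK⟩ := exists_card_le_of_isNeighbourFamily hr hφ hFb hVne hVo hc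
  obtain ⟨u, S, hS, hmax⟩ : ∃ u S, IsNeighbourFamily φ r F V c u S ∧
      ∀ u' S', IsNeighbourFamily φ r F V c u' S' → S'.card ≤ S.card := by
    let T := {n | ∃ u S, IsNeighbourFamily φ r F V c u S ∧ S.card = n}
    have hT : BddAbove T := ⟨K, by rintro _ ⟨u, S, h, rfl⟩; exact hK u S h⟩
    have hTne : T.Nonempty :=
      ⟨0, [], ∅, ⟨by simp, by simp, by simp, by simp⟩, rfl⟩
    obtain ⟨u, S, h, hn⟩ := Nat.sSup_mem hTne hT
    exact ⟨u, S, h, fun u' S' h' => hn ▸ le_csSup hT ⟨u', S', h', rfl⟩⟩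
  refine ⟨u, fun i j w hij p hp q hq => ?_⟩
  by_contra! hclose
  obtain ⟨v, q', hq', hqq', hv1, hv2⟩ := exists_word_ratio_comparable hF hr hc hρ hcρ i hq
    (wordRatio_pos hr (j :: w ++ u)) (wordRatio_le_one hr _)
  set W := j :: w with hW
  have hsub : ∀ i v, wordMap φ (i :: v) '' V ⊆ φ i '' V := by
    rintro i v _ ⟨y, hy, rfl⟩
    exact ⟨_, mapsTo_wordMap (fun j => Set.mapsTo_iff_image_subset.2 (hV j)) v hy, rfl⟩
  have hdisj : ∀ s, Disjoint (wordMap φ (i :: v) '' V) (wordMap φ (W ++ s) '' V) := fun s =>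
    (hVd hij).mono (hsub i v) (hsub j (w ++ s))
  have hfam : IsNeighbourFamily φ r F V c (W ++ u) (insert (i :: v) (S.image (W ++ ·))) := by
    have hWpos := wordRatio_pos hr W
    refine ⟨?_, ?_, ?_, ?_⟩
    · simp only [Finset.forall_mem_insert, Finset.forall_mem_image]
      refine ⟨hv1, fun s hs => ?_⟩
      rw [wordRatio_append, wordRatio_append, mul_left_comm]
      exact mul_le_mul_of_nonneg_left (hS.le_ratio s hs) hWpos.le
    · simp only [Finset.forall_mem_insert, Finset.forall_mem_image]
      refine ⟨hv2, fun s hs => ?_⟩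
      rw [wordRatio_append, wordRatio_append]
      exact mul_le_mul_of_nonneg_left (hS.ratio_le s hs) hWpos.le
    · simp only [Finset.forall_mem_insert, Finset.forall_mem_image]
      refine ⟨⟨p, hp, q', hq', hqq' ▸ hclose⟩, fun s hs => ?_⟩
      obtain ⟨p', hp', q'', hq'', h⟩ := hS.close s hs
      refine ⟨p', hp', q'', hq'', ?_⟩
      rw [wordMap_append, wordMap_append, isSimilarity_wordMap hφ W, wordRatio_append]
      exact mul_le_mul_of_nonneg_left h hWpos.le
    · simp only [Finset.forall_mem_insert, Finset.forall_mem_image]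
      refine ⟨⟨fun h => absurd rfl h, fun s _ _ => hdisj s⟩, fun s hs =>
        ⟨fun _ => (hdisj s).symm, fun s' hs' hne => ?_⟩⟩
      have himg : ∀ s, wordMap φ (W ++ s) '' V = wordMap φ W '' (wordMap φ s '' V) := fun s => by
        rw [Set.image_image]
        simp only [wordMap_append]
      rw [himg, himg, Set.disjoint_image_iff ((isSimilarity_wordMap hφ W).injective hWpos)]
      exact hS.disjoint s hs s' hs' fun h => hne (by rw [h])
  have hcard := hmax _ _ hfam
  rw [Finset.card_insert_of_notMem, Finset.card_image_of_injective _ (List.append_right_injective W)]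
    at hcard
  · omega
  · rw [Finset.mem_image]
    rintro ⟨s, -, hs⟩
    simp only [hW, List.cons_append, List.cons.injEq] at hs
    exact hij hs.1.symm

end Separation

section Counting

lemma exists_rpow_sum_le_one {n : ℕ} {a : Fin n → ℝ} (ha : ∀ k, 0 < a k) {D : ℝ} (hD : 0 < D)
    (hsum : ∑ k, a k ^ D < 1) : ∃ s ∈ Set.Ioo 0 D, ∑ k, a k ^ s ≤ 1 := by
  have hcont : Continuous fun s : ℝ => ∑ k, a k ^ s :=
    continuous_finsetSum _ fun k _ => Real.continuous_const_rpow (ha k).ne'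
  have h1 : ∀ᶠ s in 𝓝[<] D, ∑ k, a k ^ s < 1 :=
    ((hcont.tendsto D).eventually (gt_mem_nhds hsum)).filter_mono nhdsWithin_le_nhds
  obtain ⟨s, hs, hs'⟩ := (h1.and (Ioo_mem_nhdsLT hD)).exists
  exact ⟨s, hs', hs.le⟩

lemma similarityDimension_pos {ι : Type*} [Fintype ι] [Nontrivial ι] {r : ι → ℝ}
    (hr : ∀ j, r j ∈ Set.Ioo (0 : ℝ) 1) {D : ℝ} (hD : ∑ j, r j ^ D = 1) : 0 < D := by
  by_contra! h
  have h1 : ∑ _j : ι, (1 : ℝ) ≤ ∑ j, r j ^ D := Finset.sum_le_sum fun j _ =>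
    Real.one_le_rpow_of_pos_of_le_one_of_nonpos (hr j).1 (hr j).2.le h
  have h2 : (1 : ℝ) < Fintype.card ι := by exact_mod_cast Fintype.one_lt_card
  simp only [Finset.sum_const, Finset.card_univ, nsmul_eq_mul, mul_one] at h1
  linarith

/-- The number of `δ`-separated points in a cylinder below the piece `φ j '' F` which are
`δ`-close to another piece grows with an exponent smaller than the similarity dimension. -/
lemma exists_card_near_le {ι E : Type*} [Fintype ι] [Nontrivial ι] [NormedAddCommGroup E]
    [NormedSpace ℝ E] [FiniteDimensional ℝ E] [StrictConvexSpace ℝ E] {φ : ι → E → E} {r : ι → ℝ}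
    (hr : ∀ j, r j ∈ Set.Ioo (0 : ℝ) 1) (hφ : ∀ j, IsSimilarity (φ j) (r j)) {F V : Set E}
    (hFb : Bornology.IsBounded F) (hF : F ⊆ ⋃ j, φ j '' F) (hVne : V.Nonempty) (hVo : IsOpen V)
    (hV : ∀ j, φ j '' V ⊆ V) (hVd : Pairwise fun i j => Disjoint (φ i '' V) (φ j '' V))
    {D : ℝ} (hD : ∑ j, r j ^ D = 1) :
    ∃ s ∈ Set.Ioo 0 D, ∃ C, 0 ≤ C ∧ ∀ j w δ (P : Finset E), 0 < δ →
      (P : Set E) ⊆ wordMap φ (j :: w) '' F → PairwiseFar δ P →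
      (∀ y ∈ P, ∃ i ≠ j, ∃ q ∈ F, dist y (φ i q) ≤ δ) →
      (P.card : ℝ) ≤ C * ((wordRatio r (j :: w) / δ) ^ s + 1) := by
  classical
  obtain ⟨u, hu⟩ := exists_separating_word hr hφ hFb hF hVne hVo hV hVd
  obtain ⟨n, b, hbne, hcover, hbsum⟩ := exists_complementary_words hF hr hD u
  have hupos := wordRatio_pos hr u
  have hpos := wordRatio_pos hr
  obtain ⟨s, hs, hbs⟩ := exists_rpow_sum_le_one (fun k => hpos (b k))
    (similarityDimension_pos hr hD) (by
      rw [hbsum]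
      exact sub_lt_self 1 (Real.rpow_pos_of_pos hupos D))
  obtain ⟨_, ρ, _, hρ, hrρ⟩ := exists_uniform_ratio_bounds hr
  have hbρ : ∀ k, wordRatio r (b k) ≤ ρ := fun k => by
    obtain ⟨a, l, hal⟩ := List.exists_cons_of_ne_nil (hbne k)
    rw [hal, wordRatio_cons]
    exact (mul_le_of_le_one_right (hr a).1.le (wordRatio_le_one hr l)).trans (hrρ a).2
  obtain ⟨c, hc, hc1, hbc⟩ : ∃ c : ℝ, 0 < c ∧ c ≤ 1 ∧ ∀ k, c ≤ wordRatio r (b k) := by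
    rcases isEmpty_or_nonempty (Fin n) with hn | hn
    · exact ⟨1, one_pos, le_rfl, fun k => hn.elim k⟩
    · obtain ⟨k, hk⟩ := Finite.exists_min fun k => wordRatio r (b k)
      exact ⟨_, hpos (b k), wordRatio_le_one hr _, hk⟩
  obtain ⟨K, hK⟩ : ∃ K, K = (wordRatio r u)⁻¹ := ⟨_, rfl⟩
  have hKpos : 0 < K := hK ▸ inv_pos.2 hupos
  obtain ⟨R, hR⟩ := hFb.subset_closedBall 0
  obtain ⟨M, hM⟩ := exists_card_le_of_separated E (K * R) one_pos
  have hsmall : ∀ w δ (P : Finset E), 0 < δ → (P : Set E) ⊆ wordMap φ w '' F →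
      PairwiseFar δ P → wordRatio r w < K * δ → P.card ≤ M := by
    intro w δ P hδ hPF hP hw
    refine hM P (wordMap φ w 0) δ hδ (fun y hy => ?_) fun y hy z hz hyz => ?_
    · obtain ⟨p, hp, rfl⟩ := hPF hy
      rw [isSimilarity_wordMap hφ w]
      calc wordRatio r w * dist p 0 ≤ K * δ * R :=
            mul_le_mul hw.le (hR hp) dist_nonneg (by positivity)
        _ = δ * (K * R) := by ring
    · simpa using (hP y hy z hz hyz).le
  have hκ : 0 < c * K := mul_pos hc hKpos
  obtain ⟨C, hC⟩ : ∃ C, C = (M : ℝ) / (c * K) ^ s := ⟨_, rfl⟩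
  have hC0 : 0 ≤ C := hC ▸ by positivity
  have hbase : ∀ w δ (P : Finset E), 0 < δ → (P : Set E) ⊆ wordMap φ w '' F →
      PairwiseFar δ P → c * K * δ ≤ wordRatio r w → wordRatio r w < K * δ →
      (P.card : ℝ) ≤ C * (wordRatio r w / δ) ^ s := by
    intro w δ P hδ hPF hP hw hw'
    have h1 : (c * K) ^ s ≤ (wordRatio r w / δ) ^ s :=
      Real.rpow_le_rpow hκ.le ((le_div_iff₀ hδ).2 hw) hs.1.le
    calc (P.card : ℝ) ≤ M := by exact_mod_cast hsmall w δ P hδ hPF hP hw'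
      _ = C * (c * K) ^ s := by
        rw [hC, div_mul_cancel₀ _ (Real.rpow_pos_of_pos hκ s).ne']
      _ ≤ _ := mul_le_mul_of_nonneg_left h1 hC0
  have hind : ∀ k : ℕ, ∀ j w δ (P : Finset E), 0 < δ →
      (P : Set E) ⊆ wordMap φ (j :: w) '' F → PairwiseFar δ P →
      (∀ y ∈ P, ∃ i ≠ j, ∃ q ∈ F, dist y (φ i q) ≤ δ) →
      c * K * δ ≤ wordRatio r (j :: w) → wordRatio r (j :: w) * ρ ^ k < K * δ →
      (P.card : ℝ) ≤ C * (wordRatio r (j :: w) / δ) ^ s := by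
    intro k
    induction k with
    | zero =>
      intro j w δ P hδ hPF hP _ hlow hup
      exact hbase _ δ P hδ hPF hP hlow (by simpa using hup)
    | succ k ih =>
      intro j w δ P hδ hPF hP hnear hlow hup
      rcases lt_or_ge (wordRatio r (j :: w)) (K * δ) with hlt | hge
      · exact hbase _ δ P hδ hPF hP hlow hlt
      set Q : Fin n → Finset E := fun l => P.filter (· ∈ wordMap φ (j :: (w ++ b l)) '' F)
      have hPQ : P ⊆ Finset.univ.biUnion Q := by
        intro y hy
        obtain ⟨z, hz, hzy⟩ := hPF hy
        rcases hcover z hz with ⟨p, hp, rfl⟩ | ⟨l, p, hp, rfl⟩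
        · obtain ⟨i, hij, q, hq, hd⟩ := hnear y hy
          have h := hu i j w hij p hp q hq
          rw [wordMap_append, hzy, wordRatio_append] at h
          have h2 : wordRatio r (j :: w) < K * δ := by
            rw [hK, ← div_eq_inv_mul, lt_div_iff₀ hupos]
            exact h.trans_le hd
          exact absurd h2 hge.not_gt
        · refine Finset.mem_biUnion.2 ⟨l, Finset.mem_univ l, Finset.mem_filter.2 ⟨hy, p, hp, ?_⟩⟩
          rw [← hzy, ← wordMap_append, List.cons_append]
      have hsplit : ∀ l, wordRatio r (j :: (w ++ b l)) =
          wordRatio r (j :: w) * wordRatio r (b l) := fun l => by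
        rw [← wordRatio_append, List.cons_append]
      have hQ : ∀ l, ((Q l).card : ℝ) ≤
          C * (wordRatio r (j :: w) / δ) ^ s * wordRatio r (b l) ^ s := by
        intro l
        have h := ih j (w ++ b l) δ (Q l) hδ
          (fun y hy => (Finset.mem_filter.1 hy).2) (hP.mono (Finset.filter_subset _ _))
          (fun y hy => hnear y (Finset.mem_filter.1 hy).1) ?_ ?_
        · rwa [hsplit, mul_div_right_comm, Real.mul_rpow (div_pos (hpos _) hδ).le (hpos _).le,
            ← mul_assoc] at h
        · rw [hsplit, mul_assoc, mul_comm]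
          exact mul_le_mul hge (hbc l) hc.le (hpos _).le
        · refine lt_of_le_of_lt ?_ hup
          rw [hsplit, pow_succ', mul_assoc]
          exact mul_le_mul_of_nonneg_left
            (mul_le_mul_of_nonneg_right (hbρ l) (pow_nonneg hρ.1.le k)) (hpos _).le
      calc (P.card : ℝ) ≤ ∑ l, ((Q l).card : ℝ) := by
            exact_mod_cast (Finset.card_le_card hPQ).trans Finset.card_biUnion_le
        _ ≤ ∑ l, C * (wordRatio r (j :: w) / δ) ^ s * wordRatio r (b l) ^ s :=
            Finset.sum_le_sum fun l _ => hQ l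
        _ = C * (wordRatio r (j :: w) / δ) ^ s * ∑ l, wordRatio r (b l) ^ s := by
            rw [Finset.mul_sum]
        _ ≤ C * (wordRatio r (j :: w) / δ) ^ s :=
            mul_le_of_le_one_right
              (mul_nonneg hC0 (Real.rpow_nonneg (div_pos (hpos _) hδ).le s)) hbs
  refine ⟨s, hs, C + M, by positivity, fun j w δ P hδ hPF hP hnear => ?_⟩
  have hrpow : 0 ≤ (wordRatio r (j :: w) / δ) ^ s :=
    Real.rpow_nonneg (div_pos (hpos _) hδ).le s
  have hM0 : (0 : ℝ) ≤ M := M.cast_nonneg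
  rcases lt_or_ge (wordRatio r (j :: w)) (K * δ) with hlt | hge
  · have h : (P.card : ℝ) ≤ M := by exact_mod_cast hsmall _ δ P hδ hPF hP hlt
    nlinarith [mul_nonneg hC0 hrpow, mul_nonneg hM0 hrpow]
  · obtain ⟨k, hk⟩ := exists_pow_lt_of_lt_one (mul_pos hKpos hδ) hρ.2
    have h := hind k j w δ P hδ hPF hP hnear ?_ ?_
    · nlinarith [mul_nonneg hC0 hrpow, mul_nonneg hM0 hrpow]
    · rw [mul_assoc]
      exact (mul_le_of_le_one_left (mul_pos hKpos hδ).le hc1).trans hge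
    · exact (mul_le_of_le_one_left (pow_nonneg hρ.1.le k) (wordRatio_le_one hr _)).trans_lt hk

end Counting

section Renewal

variable {m : ℕ} {ι : Type*} [Fintype ι]
  {φ : ι → EuclideanSpace ℝ (Fin m) → EuclideanSpace ℝ (Fin m)} {r : ι → ℝ}
  {F : Set (EuclideanSpace ℝ (Fin m))} {x : ℝ}

lemma boxCount_le_sum (hr : ∀ j, 0 < r j) (hφ : ∀ j, IsSimilarity (φ j) (r j))
    (hFb : Bornology.IsBounded F) (hF : F ⊆ ⋃ j, φ j '' F) (hx : 0 < x) :
    boxCount F x ≤ ∑ j, boxCount F (r j * x) := by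
  classical
  obtain ⟨P, hPF, hP, hcard⟩ := exists_card_eq_boxCount hFb hx
  have hsub : P ⊆ Finset.univ.biUnion fun j => P.filter (· ∈ φ j '' F) := by
    intro y hy
    obtain ⟨j, hj⟩ := Set.mem_iUnion.1 (hF (hPF hy))
    exact Finset.mem_biUnion.2 ⟨j, Finset.mem_univ j, Finset.mem_filter.2 ⟨hy, hj⟩⟩
  rw [← hcard]
  exact (Finset.card_le_card hsub).trans <| Finset.card_biUnion_le.trans <|
    Finset.sum_le_sum fun j _ => card_image_le_boxCount (hφ j) (hr j) hFb hx
      (fun y hy => (Finset.mem_filter.1 hy).2) (hP.mono (Finset.filter_subset _ _))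

/-- The sum of the box counts of the pieces exceeds the box count of the attractor at most by the
number of separated points of the pieces that are close to other pieces. -/
lemma sum_boxCount_le (hr : ∀ j, 0 < r j) (hφ : ∀ j, IsSimilarity (φ j) (r j))
    (hFb : Bornology.IsBounded F) (hF : ∀ j, φ j '' F ⊆ F) (hx : 0 < x) {B : ι → ℝ}
    (hB : ∀ j (P : Finset (EuclideanSpace ℝ (Fin m))), (P : Set _) ⊆ φ j '' F →
      PairwiseFar (2 / x) P → (∀ y ∈ P, ∃ i ≠ j, ∃ q ∈ F, dist y (φ i q) ≤ 2 / x) →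
      (P.card : ℝ) ≤ B j) :
    ∑ j, (boxCount F (r j * x) : ℝ) ≤ boxCount F x + ∑ j, B j := by
  classical
  have hpack : ∀ j, ∃ P : Finset (EuclideanSpace ℝ (Fin m)), (P : Set _) ⊆ φ j '' F ∧
      PairwiseFar (2 / x) P ∧ P.card = boxCount F (r j * x) := by
    intro j
    obtain ⟨Q, hQF, hQ, hcard⟩ := exists_card_eq_boxCount hFb (mul_pos (hr j) hx)
    refine ⟨Q.image (φ j), ?_, ?_, ?_⟩
    · rw [Finset.coe_image]
      exact Set.image_mono hQF
    · simp only [PairwiseFar, Finset.forall_mem_image]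
      intro y hy z hz hyz
      have h := hQ y hy z hz fun h => hyz (by rw [h])
      rw [div_lt_iff₀ (mul_pos (hr j) hx)] at h
      rw [hφ, div_lt_iff₀ hx]
      linarith
    · rw [Finset.card_image_of_injective _ ((hφ j).injective (hr j)), hcard]
  choose P hPF hP hcard using hpack
  let near : ι → EuclideanSpace ℝ (Fin m) → Prop :=
    fun j y => ∃ i ≠ j, ∃ q ∈ F, dist y (φ i q) ≤ 2 / x
  let G : ι → Finset (EuclideanSpace ℝ (Fin m)) := fun j => (P j).filter (¬ near j ·)
  have hfar : ∀ i j, i ≠ j → ∀ y ∈ G i, ∀ z ∈ G j, 2 / x < dist y z := by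
    intro i j hij y hy z hz
    obtain ⟨q, hq, rfl⟩ := hPF j (Finset.mem_filter.1 hz).1
    by_contra! hle
    exact (Finset.mem_filter.1 hy).2 ⟨j, hij.symm, q, hq, hle⟩
  have hdisj : Set.PairwiseDisjoint (Finset.univ : Finset ι) G := by
    intro i _ j _ hij
    refine Finset.disjoint_left.2 fun y hy hy' => ?_
    have h := hfar i j hij y hy y hy'
    rw [dist_self] at h
    exact h.not_ge (by positivity)
  have hgood : ∑ j, (G j).card ≤ boxCount F x := by
    rw [← Finset.card_biUnion hdisj]
    refine card_le_boxCount hFb hx (fun y hy => ?_) fun y hy z hz hyz => ?_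
    · obtain ⟨j, -, hj⟩ := Finset.mem_biUnion.1 hy
      exact hF j (hPF j (Finset.mem_filter.1 hj).1)
    · obtain ⟨i, -, hi⟩ := Finset.mem_biUnion.1 hy
      obtain ⟨j, -, hj⟩ := Finset.mem_biUnion.1 hz
      by_cases hij : i = j
      · subst hij
        exact hP i y (Finset.mem_filter.1 hi).1 z (Finset.mem_filter.1 hj).1 hyz
      · exact hfar i j hij y hi z hj
  have hpiece : ∀ j, (boxCount F (r j * x) : ℝ) ≤ (G j).card + B j := by
    intro j
    have h := hB j ((P j).filter (near j ·))
      (fun y hy => hPF j (Finset.mem_filter.1 hy).1) ((hP j).mono (Finset.filter_subset _ _))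
      fun y hy => (Finset.mem_filter.1 hy).2
    have hsum : (((P j).filter (near j ·)).card : ℝ) + (G j).card = (P j).card := by
      exact_mod_cast Finset.card_filter_add_card_filter_not (near j)
    rw [← hcard]
    linarith
  calc ∑ j, (boxCount F (r j * x) : ℝ) ≤ ∑ j, ((G j).card + B j) :=
        Finset.sum_le_sum fun j _ => hpiece j
    _ = ((∑ j, (G j).card : ℕ) : ℝ) + ∑ j, B j := by
        rw [Finset.sum_add_distrib, Nat.cast_sum]
    _ ≤ boxCount F x + ∑ j, B j := by gcongr

end Renewal

/-- For a self-similar system on `ℝ^m` satisfying the open set condition, with attractor `F`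
and similarity dimension `D`, the error term of the renewal equation for the box-counting
function is `O(x^{D-ε})`: there are `γ, ε > 0` with
`|N_B(F,x) - ∑_j N_B(F, r_j x)| ≤ γ x^{D-ε}` for all `x ≥ 1`. -/
theorem stmt16 {m N : ℕ} (hN : 2 ≤ N)
    (φ : Fin N → EuclideanSpace ℝ (Fin m) → EuclideanSpace ℝ (Fin m))
    (r : Fin N → ℝ) (hr : ∀ j, r j ∈ Set.Ioo (0 : ℝ) 1)
    (hsim : ∀ j, IsSimilarity (φ j) (r j))
    (hOSC : ∃ V : Set (EuclideanSpace ℝ (Fin m)), V.Nonempty ∧ IsOpen V ∧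
      (∀ j, φ j '' V ⊆ V) ∧ Pairwise fun i j => Disjoint (φ i '' V) (φ j '' V))
    (F : Set (EuclideanSpace ℝ (Fin m)))
    (hFne : F.Nonempty) (hFc : IsCompact F) (hFinv : F = ⋃ j, φ j '' F)
    (D : ℝ) (hD : ∑ j, r j ^ D = 1) :
    ∃ γ : ℝ, 0 < γ ∧ ∃ ε : ℝ, 0 < ε ∧
      ∀ x : ℝ, 1 ≤ x →
        |(boxCount F x : ℝ) - ∑ j, (boxCount F (r j * x) : ℝ)| ≤ γ * x ^ (D - ε) := by
  have : Nontrivial (Fin N) := Fin.nontrivial_iff_two_le.2 hN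
  obtain ⟨V, hVne, hVo, hV, hVd⟩ := hOSC
  have hFb := hFc.isBounded
  have hpieces : ∀ j, φ j '' F ⊆ F := fun j => by
    conv_rhs => rw [hFinv]
    exact Set.subset_iUnion (fun j => φ j '' F) j
  obtain ⟨s, hs, C, hC, hcount⟩ :=
    exists_card_near_le hr hsim hFb hFinv.subset hVne hVo hV hVd hD
  refine ⟨N * (2 * C) + 1, by positivity, D - s, sub_pos.2 hs.2, fun x hx => ?_⟩
  have hx0 : 0 < x := one_pos.trans_le hx
  rw [sub_sub_cancel]
  have hlower : (boxCount F x : ℝ) ≤ ∑ j, (boxCount F (r j * x) : ℝ) := by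
    exact_mod_cast boxCount_le_sum (fun j => (hr j).1) hsim hFb hFinv.subset hx0
  have hupper : ∑ j, (boxCount F (r j * x) : ℝ) ≤ boxCount F x + ∑ _j : Fin N, 2 * C * x ^ s := by
    refine sum_boxCount_le (fun j => (hr j).1) hsim hFb hpieces hx0 fun j P hPF hP hnear => ?_
    have h := hcount j [] (2 / x) P (by positivity) hPF hP hnear
    have h1 : (wordRatio r [j] / (2 / x)) ^ s ≤ x ^ s := by
      refine Real.rpow_le_rpow (div_pos (wordRatio_pos hr _) (by positivity)).le ?_ hs.1.le
      rw [div_le_iff₀ (by positivity), mul_div_cancel₀ _ hx0.ne']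
      exact (wordRatio_le_one hr _).trans one_le_two
    have h2 : 1 ≤ x ^ s := Real.one_le_rpow hx hs.1.le
    calc (P.card : ℝ) ≤ C * ((wordRatio r [j] / (2 / x)) ^ s + 1) := h
      _ ≤ C * (x ^ s + x ^ s) := by gcongr
      _ = 2 * C * x ^ s := by ring
  rw [abs_of_nonpos (sub_nonpos.2 hlower)]
  simp only [Finset.sum_const, Finset.card_univ, Fintype.card_fin, nsmul_eq_mul] at hupper
  have h3 : 0 ≤ x ^ s := Real.rpow_nonneg hx0.le s
  linarith
end

section
/- Let f : (0,∞) → [0,∞) be a nondecreasing function such that f(x) = 0 for all x in some interval (0,x_0) with x_0 > 0, and f(x) → ∞ as x → ∞. Then the exponent of f equals the dimension of f; that is, inf{α ≥ 0 : f(x) = O(x^α) as x → ∞} = inf{t > 0 : ∫_0^∞ f(x)·x^{−t−1} dx < ∞} (with the convention that the infimum of the empty set is +∞). -/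
open Filter Topology MeasureTheory Asymptotics

/-- A nonnegative nondecreasing function whose Mellin-type integral at `t > 0` converges is
`O(x ^ t)`. -/
theorem isBigO_rpow_of_integrableOn_mul_rpow {f : ℝ → ℝ}
    (hnn : ∀ x : ℝ, 0 < x → 0 ≤ f x) (hmono : MonotoneOn f (Set.Ioi (0 : ℝ)))
    {t : ℝ} (ht : 0 < t)
    (hint : IntegrableOn (fun x : ℝ => f x * x ^ (-t - 1)) (Set.Ioi (0 : ℝ))) :
    f =O[atTop] fun x : ℝ => x ^ t := by
  refine IsBigO.of_bound (t * ∫ x in Set.Ioi (0 : ℝ), f x * x ^ (-t - 1)) ?_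
  filter_upwards [eventually_gt_atTop (0 : ℝ)] with x hx
  have hsub : Set.Ioi x ⊆ Set.Ioi (0 : ℝ) := Set.Ioi_subset_Ioi hx.le
  have hle : ∫ u in Set.Ioi x, f x * u ^ (-t - 1) ≤
      ∫ u in Set.Ioi (0 : ℝ), f u * u ^ (-t - 1) := by
    calc ∫ u in Set.Ioi x, f x * u ^ (-t - 1)
        ≤ ∫ u in Set.Ioi x, f u * u ^ (-t - 1) := by
          refine setIntegral_mono_on
            ((integrableOn_Ioi_rpow_of_lt (by linarith) hx).const_mul _)
            (hint.mono_set hsub) measurableSet_Ioi fun u hu => ?_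
          exact mul_le_mul_of_nonneg_right (hmono hx (hsub hu) (le_of_lt hu))
            (Real.rpow_nonneg (le_of_lt (hsub hu)) _)
      _ ≤ _ := by
          refine setIntegral_mono_set hint ?_ hsub.eventuallyLE
          filter_upwards [ae_restrict_mem measurableSet_Ioi] with u hu
          exact mul_nonneg (hnn u hu) (Real.rpow_nonneg (le_of_lt hu) _)
  rw [integral_const_mul, integral_Ioi_rpow_of_lt (by linarith) hx,
    show -t - 1 + 1 = -t by ring, neg_div_neg_eq, Real.rpow_neg hx.le] at hle
  have hxt : 0 < x ^ t := Real.rpow_pos_of_pos hx t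
  rw [Real.norm_of_nonneg (hnn x hx), Real.norm_of_nonneg hxt.le]
  have heq : f x = t * (f x * ((x ^ t)⁻¹ / t)) * x ^ t := by field_simp
  rw [heq]
  gcongr

/-- A nondecreasing function vanishing near `0` that is `O(x ^ α)` has convergent Mellin-type
integrals at every `t > α`. -/
theorem integrableOn_mul_rpow_of_isBigO_rpow {f : ℝ → ℝ}
    (hmono : MonotoneOn f (Set.Ioi (0 : ℝ)))
    {x₀ : ℝ} (hx₀ : 0 < x₀) (hzero : ∀ x ∈ Set.Ioo (0 : ℝ) x₀, f x = 0)
    {α t : ℝ} (hO : f =O[atTop] fun x : ℝ => x ^ α) (ht : α < t) :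
    IntegrableOn (fun x : ℝ => f x * x ^ (-t - 1)) (Set.Ioi (0 : ℝ)) := by
  obtain ⟨C, hC⟩ := hO.bound
  obtain ⟨M, hM⟩ := eventually_atTop.1 (hC.and (eventually_gt_atTop (0 : ℝ)))
  have hM₀ : 0 < M := (hM M le_rfl).2
  have hcont : ContinuousOn (fun x : ℝ => x ^ (-t - 1)) (Set.Ioi (0 : ℝ)) :=
    continuousOn_id.rpow_const fun x hx => Or.inl (ne_of_gt hx)
  have h₁ : IntegrableOn (fun x : ℝ => f x * x ^ (-t - 1)) (Set.Ioo 0 x₀) :=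
    integrableOn_zero.congr_fun (fun x hx => by simp [hzero x hx]) measurableSet_Ioo
  have hIcc : Set.Icc x₀ M ⊆ Set.Ioi (0 : ℝ) := fun x hx => hx₀.trans_le hx.1
  have h₂ : IntegrableOn (fun x : ℝ => f x * x ^ (-t - 1)) (Set.Icc x₀ M) :=
    ((hmono.mono hIcc).integrableOn_isCompact isCompact_Icc).mul_continuousOn
      (hcont.mono hIcc) isCompact_Icc
  have hIoi : Set.Ioi M ⊆ Set.Ioi (0 : ℝ) := Set.Ioi_subset_Ioi hM₀.le
  have h₃ : IntegrableOn (fun x : ℝ => f x * x ^ (-t - 1)) (Set.Ioi M) := by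
    refine Integrable.mono'
      ((integrableOn_Ioi_rpow_of_lt (a := α - t - 1) (by linarith) hM₀).const_mul C) ?_ ?_
    · exact (aemeasurable_restrict_of_monotoneOn measurableSet_Ioi
        (hmono.mono hIoi)).aestronglyMeasurable.mul
        ((hcont.mono hIoi).aestronglyMeasurable measurableSet_Ioi)
    · filter_upwards [ae_restrict_mem measurableSet_Ioi] with x hx
      have hx₁ : 0 < x := hIoi hx
      have hb := (hM x (le_of_lt hx)).1
      rw [Real.norm_of_nonneg (Real.rpow_nonneg hx₁.le α)] at hb
      rw [norm_mul, Real.norm_of_nonneg (Real.rpow_nonneg hx₁.le (-t - 1)),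
        show α - t - 1 = α + (-t - 1) by ring, Real.rpow_add hx₁, ← mul_assoc]
      exact mul_le_mul_of_nonneg_right hb (Real.rpow_nonneg hx₁.le _)
  refine ((h₁.union h₂).union h₃).mono_set fun x hx => ?_
  rcases lt_or_ge x x₀ with h | h
  · exact Or.inl (Or.inl ⟨hx, h⟩)
  · rcases le_or_gt x M with h' | h'
    · exact Or.inl (Or.inr ⟨h, h'⟩)
    · exact Or.inr h'

/-- For a nondecreasing function `f : (0,∞) → [0,∞)` vanishing on some interval `(0,x₀)` and
tending to `∞` at `∞`, the exponent `α_f = inf {α ≥ 0 : f(x) = O(x^α)}` equals the dimension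
`D_f = inf {t > 0 : ∫_0^∞ f(x) x^{-t-1} dx < ∞}`; the infima are taken in the extended reals,
so that `inf ∅ = +∞`. -/
theorem stmt18 (f : ℝ → ℝ)
    (hnn : ∀ x : ℝ, 0 < x → 0 ≤ f x)
    (hmono : MonotoneOn f (Set.Ioi (0 : ℝ)))
    (x₀ : ℝ) (hx₀ : 0 < x₀) (hzero : ∀ x ∈ Set.Ioo (0 : ℝ) x₀, f x = 0)
    (hinf : Tendsto f atTop atTop) :
    sInf ((fun α : ℝ => (α : EReal)) ''
        {α : ℝ | 0 ≤ α ∧ f =O[atTop] fun x : ℝ => x ^ α}) =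
      sInf ((fun t : ℝ => (t : EReal)) ''
        {t : ℝ | 0 < t ∧
          MeasureTheory.IntegrableOn (fun x : ℝ => f x * x ^ (-t - 1)) (Set.Ioi (0 : ℝ))}) := by
  apply le_antisymm
  · refine sInf_le_sInf (Set.image_mono fun t ht => ?_)
    exact ⟨ht.1.le, isBigO_rpow_of_integrableOn_mul_rpow hnn hmono ht.1 ht.2⟩
  · refine le_sInf ?_
    rintro _ ⟨α, ⟨hα, hO⟩, rfl⟩
    refine EReal.le_of_forall_lt_iff_le.1 fun t ht => ?_
    have ht' : α < t := EReal.coe_lt_coe_iff.1 ht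
    exact sInf_le ⟨t, ⟨hα.trans_lt ht',
      integrableOn_mul_rpow_of_isBigO_rpow hmono hx₀ hzero hO ht'⟩, rfl⟩
end
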